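/- arXiv:2401.02701 — 3 statements merged into one kernel-verified Lean document; each statement's English description precedes it below -/
import Mathlib

section
/- For all real numbers x and x̄, and all real numbers y > 0 and ȳ > 0, it holds that log(1 + x²/y) ≥ log(1 + x̄²/ȳ) − x̄²/ȳ + 2·x̄·x/ȳ − x̄²·(x² + y)/(ȳ·(x̄² + ȳ)). Moreover, equality holds when x = x̄ and y = ȳ. -/
theorem stmt_3 (x xb y yb : ℝ) (hy : 0 < y) (hyb : 0 < yb) :
    (Real.log (1 + x ^ 2 / y) ≥
      Real.log (1 + xb ^ 2 / yb) - xb ^ 2 / yb + 2 * xb * x / yb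
        - xb ^ 2 * (x ^ 2 + y) / (yb * (xb ^ 2 + yb))) ∧
    (x = xb → y = yb →
      Real.log (1 + x ^ 2 / y) =
        Real.log (1 + xb ^ 2 / yb) - xb ^ 2 / yb + 2 * xb * x / yb
          - xb ^ 2 * (x ^ 2 + y) / (yb * (xb ^ 2 + yb))) := by
  have hS : 0 < x ^ 2 + y := by positivity
  have hT : 0 < xb ^ 2 + yb := by positivity
  constructor
  · have hu : 0 < 1 + x ^ 2 / y := by positivity
    have hv : 0 < 1 + xb ^ 2 / yb := by positivity
    have hlog := Real.one_sub_inv_le_log_of_pos (div_pos hu hv)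
    rw [Real.log_div hu.ne' hv.ne'] at hlog
    have hgap : 1 - ((1 + x ^ 2 / y) / (1 + xb ^ 2 / yb))⁻¹ -
        (-(xb ^ 2 / yb) + 2 * xb * x / yb
          - xb ^ 2 * (x ^ 2 + y) / (yb * (xb ^ 2 + yb))) =
        ((xb ^ 2 + yb) * x - xb * (x ^ 2 + y)) ^ 2 /
          (yb * (x ^ 2 + y) * (xb ^ 2 + yb)) := by
      have hu' : 1 + x ^ 2 / y = (x ^ 2 + y) / y := by field_simp; ring
      have hv' : 1 + xb ^ 2 / yb = (xb ^ 2 + yb) / yb := by field_simp; ring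
      rw [hu', hv']
      field_simp
      ring
    have hnonneg : 0 ≤ ((xb ^ 2 + yb) * x - xb * (x ^ 2 + y)) ^ 2 /
        (yb * (x ^ 2 + y) * (xb ^ 2 + yb)) := by positivity
    linarith
  · rintro rfl rfl
    field_simp
    ring
end

section
/- Let X be a metric space, F ⊆ X a nonempty compact set, and f, Q : X → ℝ continuous functions such that Q(x) ≥ 0 for all x ∈ F and the feasible set {x ∈ F : Q(x) ≤ 0} is nonempty. Then the constrained minimum equals the dual value: min{f(x) : x ∈ F, Q(x) ≤ 0} = sup_{λ ≥ 0} min_{x∈F} (f(x) + λ·Q(x)). -/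
/-- On a compact set, a sufficiently large penalty weight makes the penalized objective exceed
any level lying strictly below the constrained values of `f`. -/
theorem exists_penalty_forall_le {X : Type*} [TopologicalSpace X] {F : Set X} (hF : IsCompact F)
    {f Q : X → ℝ} (hf : Continuous f) (hQ : Continuous Q) (hQ0 : ∀ x ∈ F, 0 ≤ Q x) {c : ℝ}
    (hc : ∀ x ∈ F, Q x ≤ 0 → c < f x) :
    ∃ lam : ℝ, 0 ≤ lam ∧ ∀ x ∈ F, c ≤ f x + lam * Q x := by
  have hK : IsCompact (F ∩ {x | f x ≤ c}) := hF.inter_right (isClosed_le hf continuous_const)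
  rcases (F ∩ {x | f x ≤ c}).eq_empty_or_nonempty with hE | hne
  · refine ⟨0, le_rfl, fun x hx => ?_⟩
    by_contra! h
    have hmem : x ∈ F ∩ {x | f x ≤ c} := ⟨hx, show f x ≤ c by linarith⟩
    simp [hE] at hmem
  · obtain ⟨y, ⟨hyF, hyc⟩, hymin⟩ := hK.exists_isMinOn hne hQ.continuousOn
    obtain ⟨z, ⟨hzF, hzc⟩, hzmin⟩ := hK.exists_isMinOn hne hf.continuousOn
    have hm : 0 < Q y := by
      by_contra! h
      exact (hc y hyF h).not_ge hyc
    have hlam : 0 ≤ (c - f z) / Q y := div_nonneg (sub_nonneg.2 hzc) hm.le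
    refine ⟨(c - f z) / Q y, hlam, fun x hx => ?_⟩
    rcases le_total (f x) c with h | h
    · have h1 : f z ≤ f x := hzmin ⟨hx, h⟩
      have h2 : Q y ≤ Q x := hymin ⟨hx, h⟩
      have h3 := mul_le_mul_of_nonneg_left h2 hlam
      rw [div_mul_cancel₀ _ hm.ne'] at h3
      linarith
    · linarith [mul_nonneg hlam (hQ0 x hx)]

theorem stmt_9 {X : Type*} [MetricSpace X] (F : Set X)
    (hFc : IsCompact F) (hFne : F.Nonempty)
    (f Q : X → ℝ) (hf : Continuous f) (hQcont : Continuous Q)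
    (hQ0 : ∀ x ∈ F, 0 ≤ Q x) (hfeas : ∃ x ∈ F, Q x ≤ 0) :
    sInf (f '' {x ∈ F | Q x ≤ 0}) =
      sSup ((fun lam : ℝ => sInf ((fun x => f x + lam * Q x) '' F)) '' Set.Ici 0) := by
  obtain ⟨w, hwF, hwQ⟩ := hfeas
  have hbdd : BddBelow (f '' {x ∈ F | Q x ≤ 0}) :=
    (hFc.bddBelow_image hf.continuousOn).mono (Set.image_mono fun _ hx => hx.1)
  refine (IsLUB.csSup_eq ⟨?_, fun b hb => ?_⟩ (Set.nonempty_Ici.image _)).symm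
  · rintro _ ⟨lam, hlam, rfl⟩
    refine le_csInf ⟨_, w, ⟨hwF, hwQ⟩, rfl⟩ ?_
    rintro _ ⟨y, ⟨hyF, hyQ⟩, rfl⟩
    have hL : Continuous fun x => f x + lam * Q x := by fun_prop
    refine (csInf_le (hFc.bddBelow_image hL.continuousOn) ⟨y, hyF, rfl⟩).trans ?_
    simp [le_antisymm hyQ (hQ0 y hyF)]
  · refine le_of_forall_lt_imp_le_of_dense fun c hcp => ?_
    obtain ⟨lam, hlam, hle⟩ := exists_penalty_forall_le hFc hf hQcont hQ0
      fun x hx hxQ => hcp.trans_le (csInf_le hbdd ⟨x, ⟨hx, hxQ⟩, rfl⟩)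
    refine le_trans (le_csInf (hFne.image _) ?_) (hb ⟨lam, hlam, rfl⟩)
    rintro _ ⟨x, hx, rfl⟩
    exact hle x hx
end

section
/- Let X be a metric space, F ⊆ X a nonempty compact set, f : X → ℝ continuous, and Q₁, …, Q_J : X → ℝ continuous functions with Q_j(x) ≥ 0 for all x ∈ F and all j. Let μ₁, …, μ_J be positive reals and assume the feasible set {x ∈ F : Q_j(x) ≤ 0 for all j} is nonempty. Then min{f(x) : x ∈ F, Q_j(x) ≤ 0 for all j} = sup_{χ ≥ 0} min_{x∈F} (f(x) + χ·∑_{j=1}^J μ_j·Q_j(x)). -/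
/-- Exact penalization up to a level: if a continuous penalty `P`, nonnegative on a compact set,
is positive wherever `f ≤ c`, then a large enough multiple of it lifts `f` to at least `c`. -/
theorem IsCompact.exists_penalty_le {X : Type*} [TopologicalSpace X] {F : Set X}
    (hF : IsCompact F) {f P : X → ℝ} (hf : Continuous f) (hP : Continuous P)
    (hP0 : ∀ x ∈ F, 0 ≤ P x) {c : ℝ} (hpos : ∀ x ∈ F, f x ≤ c → 0 < P x) :
    ∃ χ : ℝ, 0 ≤ χ ∧ ∀ x ∈ F, c ≤ f x + χ * P x := by
  have hK : IsCompact (F ∩ {x | f x ≤ c}) :=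
    hF.inter_right (isClosed_le hf continuous_const)
  rcases (F ∩ {x | f x ≤ c}).eq_empty_or_nonempty with hemp | hne
  · refine ⟨0, le_rfl, fun x hx => ?_⟩
    by_contra! h
    have hmem : x ∈ F ∩ {x | f x ≤ c} := ⟨hx, by simpa using h.le⟩
    simp [hemp] at hmem
  · obtain ⟨y, hy, hymin⟩ := hK.exists_isMinOn hne hP.continuousOn
    obtain ⟨z, hz, hzmin⟩ := hK.exists_isMinOn hne hf.continuousOn
    have hPy : 0 < P y := hpos y hy.1 hy.2
    have hχ : 0 ≤ (c - f z) / P y := div_nonneg (sub_nonneg.2 hz.2) hPy.le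
    refine ⟨(c - f z) / P y, hχ, fun x hx => ?_⟩
    rcases le_total (f x) c with h | h
    · have h1 : f z ≤ f x := hzmin ⟨hx, h⟩
      have h2 : P y ≤ P x := hymin ⟨hx, h⟩
      have h3 := mul_le_mul_of_nonneg_left h2 hχ
      rw [div_mul_cancel₀ _ hPy.ne'] at h3
      linarith
    · linarith [mul_nonneg hχ (hP0 x hx)]

theorem stmt_11 {X : Type*} [MetricSpace X] (F : Set X)
    (hFc : IsCompact F) (hFne : F.Nonempty)
    (f : X → ℝ) (hf : Continuous f)
    (J : ℕ) (Q : Fin J → X → ℝ) (hQcont : ∀ j, Continuous (Q j))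
    (hQ0 : ∀ j, ∀ x ∈ F, 0 ≤ Q j x)
    (μ : Fin J → ℝ) (hμ : ∀ j, 0 < μ j)
    (hfeas : ∃ x ∈ F, ∀ j, Q j x ≤ 0) :
    sInf (f '' {x ∈ F | ∀ j, Q j x ≤ 0}) =
      sSup ((fun χ : ℝ =>
        sInf ((fun x => f x + χ * ∑ j, μ j * Q j x) '' F)) '' Set.Ici 0) := by
  have hP : Continuous fun x => ∑ j, μ j * Q j x := by fun_prop
  have hterm : ∀ x ∈ F, ∀ j ∈ Finset.univ, 0 ≤ μ j * Q j x :=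
    fun x hx j _ => mul_nonneg (hμ j).le (hQ0 j x hx)
  have hP0 : ∀ x ∈ F, 0 ≤ ∑ j, μ j * Q j x := fun x hx => Finset.sum_nonneg (hterm x hx)
  have hzero : ∀ x ∈ F, (∀ j, Q j x ≤ 0) → ∑ j, μ j * Q j x = 0 := fun x hx h =>
    Finset.sum_eq_zero fun j _ => by rw [le_antisymm (h j) (hQ0 j x hx), mul_zero]
  have hbdd : ∀ χ : ℝ, BddBelow ((fun x => f x + χ * ∑ j, μ j * Q j x) '' F) := fun χ =>
    (hFc.image (hf.add (continuous_const.mul hP))).bddBelow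
  have hne : (f '' {x ∈ F | ∀ j, Q j x ≤ 0}).Nonempty := by
    obtain ⟨x, hx, h⟩ := hfeas
    exact ⟨f x, x, ⟨hx, h⟩, rfl⟩
  have hweak : ∀ d ∈ (fun χ : ℝ => sInf ((fun x => f x + χ * ∑ j, μ j * Q j x) '' F)) ''
      Set.Ici 0, d ≤ sInf (f '' {x ∈ F | ∀ j, Q j x ≤ 0}) := by
    rintro _ ⟨χ, -, rfl⟩
    refine le_csInf hne ?_
    rintro _ ⟨x, ⟨hx, h⟩, rfl⟩
    exact csInf_le (hbdd χ) ⟨x, hx, by simp [hzero x hx h]⟩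
  refine le_antisymm (le_of_forall_lt_imp_le_of_dense fun c hc => ?_)
    (csSup_le (Set.nonempty_Ici.image _) hweak)
  have hbddF : BddBelow (f '' {x ∈ F | ∀ j, Q j x ≤ 0}) :=
    (hFc.image hf).bddBelow.mono (Set.image_mono fun x hx => hx.1)
  obtain ⟨χ, hχ, hle⟩ := hFc.exists_penalty_le hf hP hP0 (c := c) fun x hx hxc => by
    refine (hP0 x hx).lt_of_ne' fun h0 => ?_
    have hQ : ∀ j, Q j x ≤ 0 := fun j =>
      ((mul_eq_zero.1 ((Finset.sum_eq_zero_iff_of_nonneg (hterm x hx)).1 h0 j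
        (Finset.mem_univ j))).resolve_left (hμ j).ne').le
    exact (hc.trans_le (csInf_le hbddF ⟨x, ⟨hx, hQ⟩, rfl⟩)).not_ge hxc
  refine le_trans (le_csInf (hFne.image _) ?_) (le_csSup ⟨_, hweak⟩ ⟨χ, hχ, rfl⟩)
  rintro _ ⟨x, hx, rfl⟩
  exact hle x hx
end
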